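/- Let E ⊆ ℝ^d and F ⊆ ℝ^{d'} be dust-like self-similar sets with contraction vectors ρ = (ρ_1,…,ρ_m) and τ = (τ_1,…,τ_n) respectively, where m, n ≥ 2. If E and F are Lipschitz equivalent, then V_ρ⁺ = V_τ⁺. -/

import Mathlib

open scoped BigOperators

noncomputable section

/-- `E ⊆ ℝ^d` is a dust-like self-similar set with contraction vector `ρ`:
`E` is nonempty compact, each `ρ j ∈ (0,1)`, and there are similarities `φ j`
with ratios `ρ j` such that `E = ⋃ j, φ j '' E` is a disjoint union. -/
def IsDustLike {d : ℕ} {ι : Type} [Fintype ι]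
    (E : Set (EuclideanSpace ℝ (Fin d))) (ρ : ι → ℝ) : Prop :=
  IsCompact E ∧ E.Nonempty ∧ (∀ j, ρ j ∈ Set.Ioo (0 : ℝ) 1) ∧
  ∃ φ : ι → EuclideanSpace ℝ (Fin d) → EuclideanSpace ℝ (Fin d),
    (∀ j x y, dist (φ j x) (φ j y) = ρ j * dist x y) ∧
    E = ⋃ j, φ j '' E ∧
    Pairwise fun j k => Disjoint (φ j '' E) (φ k '' E)

/-- `E` and `F` are Lipschitz equivalent: there is a bi-Lipschitz bijection between them. -/
def LipEquiv {d d' : ℕ} (E : Set (EuclideanSpace ℝ (Fin d)))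
    (F : Set (EuclideanSpace ℝ (Fin d'))) : Prop :=
  ∃ f : E → F, Function.Bijective f ∧ ∃ C : ℝ, 0 < C ∧ ∀ x y : E,
    C⁻¹ * dist (x : EuclideanSpace ℝ (Fin d)) (y : EuclideanSpace ℝ (Fin d))
      ≤ dist (f x : EuclideanSpace ℝ (Fin d')) (f y : EuclideanSpace ℝ (Fin d')) ∧
    dist (f x : EuclideanSpace ℝ (Fin d')) (f y : EuclideanSpace ℝ (Fin d'))
      ≤ C * dist (x : EuclideanSpace ℝ (Fin d)) (y : EuclideanSpace ℝ (Fin d))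

/-- `V_ρ⁺`: nonnegative rational combinations of the `log ρ_i`. -/
def Vplus {m : ℕ} (ρ : Fin m → ℝ) : Set ℝ :=
  { x | ∃ q : Fin m → ℚ, (∀ i, 0 ≤ q i) ∧ x = ∑ i, (q i : ℝ) * Real.log (ρ i) }

structure FMDust {X : Type*} [MetricSpace X] {m : ℕ} (E : Set X) (ρ : Fin m → ℝ)
    (φ : Fin m → X → X) : Prop where
  comp : IsCompact E
  ne : E.Nonempty
  pos : ∀ j, 0 < ρ j
  lt : ∀ j, ρ j < 1
  sim : ∀ j x y, dist (φ j x) (φ j y) = ρ j * dist x y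
  eq : E = ⋃ j, φ j '' E
  disj : Pairwise fun j k => Disjoint (φ j '' E) (φ k '' E)

def fmPhi {X : Type*} {m : ℕ} (φ : Fin m → X → X) : List (Fin m) → X → X
  | [] => id
  | a :: w => φ a ∘ fmPhi φ w

def fmR {m : ℕ} (ρ : Fin m → ℝ) (w : List (Fin m)) : ℝ := (w.map ρ).prod

def fmCyl {X : Type*} {m : ℕ} (E : Set X) (φ : Fin m → X → X) (w : List (Fin m)) : Set X :=
  fmPhi φ w '' E

lemma fmPhi_append {X : Type*} {m : ℕ} (φ : Fin m → X → X) (u v : List (Fin m)) :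
    fmPhi φ (u ++ v) = fmPhi φ u ∘ fmPhi φ v := by
  induction u with
  | nil => rfl
  | cons a u ih => simp [fmPhi, ih, Function.comp_assoc]

lemma fmR_append {m : ℕ} (ρ : Fin m → ℝ) (u v : List (Fin m)) :
    fmR ρ (u ++ v) = fmR ρ u * fmR ρ v := by simp [fmR]

@[simp] lemma fmR_nil {m : ℕ} (ρ : Fin m → ℝ) : fmR ρ [] = 1 := by simp [fmR]
@[simp] lemma fmR_cons {m : ℕ} (ρ : Fin m → ℝ) (a) (w) : fmR ρ (a :: w) = ρ a * fmR ρ w := by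
  simp [fmR]

lemma fmR_log {m : ℕ} (ρ : Fin m → ℝ) (h : ∀ j, 0 < ρ j) (w : List (Fin m)) :
    0 < fmR ρ w ∧ Real.log (fmR ρ w) = ∑ b, (w.count b : ℝ) * Real.log (ρ b) := by
  induction w with
  | nil => simp
  | cons a w ih =>
    refine ⟨by simpa using mul_pos (h a) ih.1, ?_⟩
    rw [fmR_cons, Real.log_mul (h a).ne' ih.1.ne', ih.2]
    simp only [List.count_cons, Nat.cast_add, add_mul, Finset.sum_add_distrib]
    rw [add_comm]
    congr 1
    simp

lemma fmR_pos {m : ℕ} {ρ : Fin m → ℝ} (h : ∀ j, 0 < ρ j) (w : List (Fin m)) : 0 < fmR ρ w :=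
  (fmR_log ρ h w).1

lemma fmR_le {m : ℕ} {ρ : Fin m → ℝ} (h : ∀ j, 0 < ρ j) {t : ℝ} (ht : ∀ j, ρ j ≤ t)
    (h0 : 0 ≤ t) (w : List (Fin m)) : fmR ρ w ≤ t ^ w.length := by
  induction w with
  | nil => simp
  | cons a w ih =>
    simp only [fmR_cons, List.length_cons, pow_succ']
    exact mul_le_mul (ht a) ih (fmR_pos h w).le h0

lemma fmR_ge {m : ℕ} {ρ : Fin m → ℝ} {t : ℝ} (ht : ∀ j, t ≤ ρ j)
    (h0 : 0 < t) (w : List (Fin m)) : t ^ w.length ≤ fmR ρ w := by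
  induction w with
  | nil => simp
  | cons a w ih =>
    simp only [fmR_cons, List.length_cons, pow_succ']
    exact mul_le_mul (ht a) ih (by positivity) (h0.le.trans (ht a))

lemma fmR_rpow {m : ℕ} {ρ : Fin m → ℝ} (h : ∀ j, 0 < ρ j) (t : ℝ) (w : List (Fin m)) :
    fmR (fun a => ρ a ^ t) w = fmR ρ w ^ t := by
  induction w with
  | nil => simp
  | cons a w ih =>
    simp only [fmR_cons, ih]
    rw [Real.mul_rpow (h a).le (fmR_pos h w).le]

namespace FMDust
variable {X : Type*} [MetricSpace X] {m : ℕ} {E : Set X} {ρ : Fin m → ℝ} {φ : Fin m → X → X}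

lemma maps (h : FMDust E ρ φ) (a : Fin m) {x : X} (hx : x ∈ E) : φ a x ∈ E := by
  rw [h.eq]; exact Set.mem_iUnion.2 ⟨a, x, hx, rfl⟩

lemma maps' (h : FMDust E ρ φ) (w) {x : X} (hx : x ∈ E) : fmPhi φ w x ∈ E := by
  induction w with
  | nil => exact hx
  | cons a w ih => exact h.maps a ih

lemma cyl_sub (h : FMDust E ρ φ) (w) : fmCyl E φ w ⊆ E := by
  rintro _ ⟨x, hx, rfl⟩; exact h.maps' w hx

lemma sim' (h : FMDust E ρ φ) (w) (x y : X) :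
    dist (fmPhi φ w x) (fmPhi φ w y) = fmR ρ w * dist x y := by
  induction w with
  | nil => simp [fmPhi]
  | cons a w ih => simp [fmPhi, h.sim, ih, mul_assoc]

lemma inj (h : FMDust E ρ φ) (a) : Function.Injective (φ a) := by
  intro x y hxy
  have := h.sim a x y
  rw [hxy, dist_self] at this
  have h2 := h.pos a
  exact dist_eq_zero.1 ((mul_eq_zero.1 this.symm).resolve_left h2.ne')

lemma inj' (h : FMDust E ρ φ) (w) : Function.Injective (fmPhi φ w) := by
  induction w with
  | nil => exact Function.injective_id
  | cons a w ih => exact (h.inj a).comp ih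

lemma cyl_split (h : FMDust E ρ φ) (w) : fmCyl E φ w = ⋃ a, fmCyl E φ (w ++ [a]) := by
  unfold fmCyl
  conv_lhs => rw [h.eq, Set.image_iUnion]
  refine Set.iUnion_congr fun a => ?_
  rw [fmPhi_append, Set.image_comp]; rfl

lemma cyl_disj (h : FMDust E ρ φ) (w) :
    Pairwise fun a b => Disjoint (fmCyl E φ (w ++ [a])) (fmCyl E φ (w ++ [b])) := by
  intro a b hab
  unfold fmCyl
  rw [fmPhi_append, fmPhi_append, Set.image_comp, Set.image_comp]
  exact (Set.disjoint_image_iff (h.inj' w)).2 (h.disj hab)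

lemma exists_sep (h : FMDust E ρ φ) : ∃ δ > 0, ∀ a b, a ≠ b → ∀ x ∈ φ a '' E, ∀ y ∈ φ b '' E,
    δ ≤ dist x y := by
  have hc : ∀ a, IsCompact (φ a '' E) := fun a => by
    refine h.comp.image ?_
    have : LipschitzWith (ρ a).toNNReal (φ a) := LipschitzWith.of_dist_le_mul fun x y => by
      rw [h.sim, Real.coe_toNNReal _ (h.pos a).le]
    exact this.continuous
  have : ∀ p : Fin m × Fin m, ∃ δ > 0, p.1 ≠ p.2 → ∀ x ∈ φ p.1 '' E, ∀ y ∈ φ p.2 '' E,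
      δ ≤ dist x y := by
    rintro ⟨a, b⟩
    by_cases hab : a = b
    · exact ⟨1, one_pos, fun hh => absurd hab hh⟩
    · obtain ⟨r, hr, hh⟩ := Metric.exists_pos_forall_lt_edist (hc a) (hc b).isClosed (h.disj hab)
      refine ⟨r, by exact_mod_cast hr, fun _ x hx y hy => ?_⟩
      have := hh x hx y hy
      rw [edist_nndist] at this
      have h2 : r < nndist x y := by exact_mod_cast this
      rw [← coe_nndist]; exact_mod_cast h2.le
  choose δ hδ hd using this
  obtain ⟨d, hd0, hdd⟩ : ∃ d > 0, ∀ p, d ≤ δ p := by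
    rcases isEmpty_or_nonempty (Fin m × Fin m) with he | he
    · exact ⟨1, one_pos, fun p => he.elim p⟩
    · obtain ⟨p, hp⟩ := Finite.exists_min δ
      exact ⟨δ p, hδ p, hp⟩
  exact ⟨d, hd0, fun a b hab x hx y hy => (hdd (a, b)).trans (hd (a, b) hab x hx y hy)⟩

lemma r_le_one (h : FMDust E ρ φ) (w) : fmR ρ w ≤ 1 := by
  simpa using fmR_le h.pos (fun j => (h.lt j).le) zero_le_one w

lemma exists_sep' (h : FMDust E ρ φ) : ∃ δ > 0, ∀ w, ∀ x ∈ fmCyl E φ w, ∀ y ∈ E,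
    y ∉ fmCyl E φ w → δ * fmR ρ w ≤ dist x y := by
  obtain ⟨δ, hδ, hs⟩ := h.exists_sep
  refine ⟨δ, hδ, fun w => ?_⟩
  induction w with
  | nil => intro x hx y hy hy'; exact absurd (by simpa [fmCyl, fmPhi] using hy) hy'
  | cons a w ih =>
    rintro _ ⟨x, hx, rfl⟩ y hy hy'
    have hyu := hy
    rw [h.eq] at hyu
    obtain ⟨b, y', hy2, rfl⟩ := Set.mem_iUnion.1 hyu
    by_cases hab : a = b
    · subst hab
      have := ih (fmPhi φ w x) ⟨x, hx, rfl⟩ y' hy2 (fun ⟨z, hz, hzz⟩ => hy' ⟨z, hz, by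
        simp [fmPhi, hzz]⟩)
      simp only [fmPhi, Function.comp, h.sim, fmR_cons]
      have h3 := mul_le_mul_of_nonneg_left this (h.pos a).le
      linarith
    · have := hs a b hab (φ a (fmPhi φ w x)) ⟨_, h.maps' w hx, rfl⟩ (φ b y') ⟨y', hy2, rfl⟩
      refine le_trans ?_ this
      have := h.r_le_one (a :: w)
      nlinarith

lemma exists_diam (h : FMDust E ρ φ) : ∃ D > 0, ∀ w, ∀ x ∈ fmCyl E φ w, ∀ y ∈ fmCyl E φ w,
    dist x y ≤ D * fmR ρ w := by
  obtain ⟨D, hD⟩ := Metric.isBounded_iff.1 h.comp.isBounded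
  refine ⟨max D 1, by positivity, ?_⟩
  rintro w _ ⟨x, hx, rfl⟩ _ ⟨y, hy, rfl⟩
  rw [h.sim', mul_comm]
  exact mul_le_mul_of_nonneg_right ((hD hx hy).trans (le_max_left _ _)) (fmR_pos h.pos w).le

lemma exists_min (h : FMDust E ρ φ) : ∃ t > 0, t ≤ 1 ∧ ∀ j, t ≤ ρ j := by
  rcases isEmpty_or_nonempty (Fin m) with he | he
  · exact ⟨1, one_pos, le_rfl, fun p => he.elim p⟩
  · obtain ⟨p, hp⟩ := Finite.exists_min ρ
    exact ⟨ρ p, h.pos p, (h.lt p).le, hp⟩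

lemma exists_max (h : FMDust E ρ φ) : ∃ t > 0, t < 1 ∧ ∀ j, ρ j ≤ t := by
  rcases isEmpty_or_nonempty (Fin m) with he | he
  · exact ⟨1/2, by norm_num, by norm_num, fun p => he.elim p⟩
  · obtain ⟨p, hp⟩ := Finite.exists_max ρ
    exact ⟨ρ p, h.pos p, (h.lt p), hp⟩

lemma exists_stop (h : FMDust E ρ φ) {t : ℝ} (ht : ∀ j, t ≤ ρ j)
    {y : X} (hy : y ∈ E) {ε : ℝ} (hε : 0 < ε) :
    ∃ j, y ∈ fmCyl E φ j ∧ (j = [] ∨ ε ≤ fmR ρ j) ∧ fmR ρ j * t ≤ ε := by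
  by_contra! hcon
  have key : ∀ N : ℕ, ∃ j : List (Fin m), j.length = N ∧ y ∈ fmCyl E φ j ∧
      (j = [] ∨ ε ≤ fmR ρ j) := by
    intro N
    induction N with
    | zero => exact ⟨[], rfl, by simpa [fmCyl, fmPhi] using hy, Or.inl rfl⟩
    | succ N ih =>
      obtain ⟨j, hj, hyj, hjj⟩ := ih
      have h1 := hcon j hyj hjj
      rw [h.cyl_split] at hyj
      obtain ⟨a, ha⟩ := Set.mem_iUnion.1 hyj
      refine ⟨j ++ [a], by simp [hj], ha, Or.inr ?_⟩
      rw [fmR_append]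
      simp only [fmR_cons, fmR_nil, mul_one]
      exact h1.le.trans (mul_le_mul_of_nonneg_left (ht a) (fmR_pos h.pos j).le)
  obtain ⟨M, hM0, hM1, hM⟩ := h.exists_max
  obtain ⟨N, hN⟩ := exists_pow_lt_of_lt_one hε hM1
  obtain ⟨j, hj, -, h2⟩ := key (N + 1)
  have h3 := fmR_le h.pos hM hM0.le j
  rw [hj, pow_succ] at h3
  have h4 : 0 < M ^ N := by positivity
  rcases h2 with rfl | h2
  · simp at hj
  · nlinarith

end FMDust

open Classical in
def fmI {X : Type*} {m : ℕ} (φ : Fin m → X → X) (p : Fin m → ℝ) (x0 : X) : ℕ → Set X → ℝ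
  | 0, A => if x0 ∈ A then 1 else 0
  | L + 1, A => ∑ b, p b * fmI φ p x0 L (φ b ⁻¹' A)

lemma fmI_iUnion {X : Type*} {m : ℕ} (φ : Fin m → X → X) (p : Fin m → ℝ) (x0 : X) (L : ℕ)
    {k : ℕ} (B : Fin k → Set X) (hB : Pairwise fun a b => Disjoint (B a) (B b)) :
    fmI φ p x0 L (⋃ a, B a) = ∑ a, fmI φ p x0 L (B a) := by
  induction L generalizing B with
  | zero =>
    simp only [fmI]
    by_cases h : ∃ a, x0 ∈ B a
    · obtain ⟨a, ha⟩ := h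
      rw [if_pos (Set.mem_iUnion.2 ⟨a, ha⟩), Finset.sum_eq_single a, if_pos ha]
      · intro b _ hb
        rw [if_neg]
        intro hb'
        exact Set.disjoint_left.1 (hB hb) hb' ha
      · simp
    · rw [if_neg (by simpa using h)]
      symm
      refine Finset.sum_eq_zero fun a _ => ?_
      rw [if_neg (fun ha => h ⟨a, ha⟩)]
  | succ L ih =>
    simp only [fmI, Set.preimage_iUnion]
    rw [Finset.sum_comm]
    refine Finset.sum_congr rfl fun b _ => ?_
    rw [ih _ (fun c d hcd => (hB hcd).preimage _), Finset.mul_sum]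

lemma fmI_mem {X : Type*} {m : ℕ} (φ : Fin m → X → X) (p : Fin m → ℝ) (x0 : X)
    (hp : ∀ a, 0 ≤ p a) (hs : ∑ a, p a = 1) (L : ℕ) (A : Set X) :
    fmI φ p x0 L A ∈ Set.Icc (0 : ℝ) 1 := by
  induction L generalizing A with
  | zero => simp only [fmI]; split_ifs <;> simp
  | succ L ih =>
    simp only [fmI]
    refine ⟨Finset.sum_nonneg fun b _ => mul_nonneg (hp b) (ih _).1, ?_⟩
    rw [← hs]
    exact Finset.sum_le_sum fun b _ => mul_le_of_le_one_right (hp b) (ih _).2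

namespace FMDust
variable {X : Type*} [MetricSpace X] {m : ℕ} {E : Set X} {ρ : Fin m → ℝ} {φ : Fin m → X → X}

lemma fmI_zero (h : FMDust E ρ φ) (p : Fin m → ℝ) {x0 : X} (hx : x0 ∈ E) (L : ℕ) (A : Set X)
    (hA : ∀ x ∈ E, x ∉ A) : fmI φ p x0 L A = 0 := by
  induction L generalizing A with
  | zero => simp only [fmI]; rw [if_neg (hA _ hx)]
  | succ L ih =>
    simp only [fmI]
    refine Finset.sum_eq_zero fun b _ => ?_
    rw [ih (φ b ⁻¹' A) (fun x hx => hA (φ b x) (h.maps b hx)), mul_zero]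

lemma fmI_one (h : FMDust E ρ φ) (p : Fin m → ℝ) (hs : ∑ a, p a = 1)
    {x0 : X} (hx : x0 ∈ E) (L : ℕ) (A : Set X)
    (hA : ∀ x ∈ E, x ∈ A) : fmI φ p x0 L A = 1 := by
  induction L generalizing A with
  | zero => simp only [fmI]; rw [if_pos (hA _ hx)]
  | succ L ih =>
    simp only [fmI]
    rw [← hs]
    refine Finset.sum_congr rfl fun b _ => ?_
    rw [ih (φ b ⁻¹' A) (fun x hx => hA (φ b x) (h.maps b hx)), mul_one]

lemma fmI_cyl (h : FMDust E ρ φ) (p : Fin m → ℝ) (hs : ∑ a, p a = 1)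
    {x0 : X} (hx : x0 ∈ E) (w : List (Fin m)) (L : ℕ) (hL : w.length ≤ L) :
    fmI φ p x0 L (fmCyl E φ w) = fmR p w := by
  induction w generalizing L with
  | nil => rw [h.fmI_one p hs hx]; simp; intro x hx; simpa [fmCyl, fmPhi] using hx
  | cons a w ih =>
    obtain _ | L := L
    · simp at hL
    simp only [fmI, fmR_cons]
    rw [Finset.sum_eq_single a]
    · have : φ a ⁻¹' (fmCyl E φ (a :: w)) = fmCyl E φ w := by
        unfold fmCyl
        simp only [fmPhi]
        rw [Set.image_comp, Set.preimage_image_eq _ (h.inj a)]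
      rw [this, ih L (by simpa using hL)]
    · intro b _ hb
      rw [h.fmI_zero p hx, mul_zero]
      rintro x hx ⟨y, hy, hxy⟩
      exact Set.disjoint_left.1 (h.disj hb) ⟨x, hx, rfl⟩ ⟨_, h.maps' w hy, hxy⟩
    · simp

lemma exists_nu (h : FMDust E ρ φ) (p : Fin m → ℝ) (hp : ∀ a, 0 ≤ p a) (hs : ∑ a, p a = 1) :
    ∃ ν : Set X → ℝ,
      (∀ (k : ℕ) (B : Fin k → Set X), (Pairwise fun a b => Disjoint (B a) (B b)) →
        ν (⋃ a, B a) = ∑ a, ν (B a)) ∧ ∀ w, ν (fmCyl E φ w) = fmR p w := by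
  obtain ⟨x0, hx⟩ := h.ne
  have : ∀ A : Set X, ∃ y, Filter.Tendsto (fun L => fmI φ p x0 L A) (Filter.hyperfilter ℕ)
      (nhds y) := by
    intro A
    obtain ⟨y, -, hy⟩ := (isCompact_Icc (a := (0:ℝ)) (b := 1)).ultrafilter_le_nhds
      ((Filter.hyperfilter ℕ).map (fun L => fmI φ p x0 L A)) (by
        rw [Filter.le_principal_iff]
        exact Filter.mem_map.2 (Filter.univ_mem' fun L => fmI_mem φ p x0 hp hs L A))
    exact ⟨y, hy⟩
  choose ν hν using this
  refine ⟨ν, fun k B hB => ?_, fun w => ?_⟩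
  · refine tendsto_nhds_unique (hν _) ?_
    simp_rw [fmI_iUnion φ p x0 _ B hB]
    exact tendsto_finsetSum _ fun a _ => hν _
  · refine tendsto_nhds_unique (hν _) ?_
    refine tendsto_const_nhds.congr' ?_
    have : ∀ᶠ L in (Filter.hyperfilter ℕ : Filter ℕ), w.length ≤ L :=
      Nat.hyperfilter_le_atTop (Filter.eventually_ge_atTop _)
    filter_upwards [this] with L hL
    rw [h.fmI_cyl p hs hx w L hL]

end FMDust

lemma fm_exists_t {n : ℕ} (hn : 2 ≤ n) (τ : Fin n → ℝ) (h0 : ∀ j, 0 < τ j) (h1 : ∀ j, τ j < 1) :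
    ∃ t : ℝ, 0 < t ∧ ∑ j, τ j ^ t = 1 := by
  have hlim : Filter.Tendsto (fun t : ℝ => ∑ j, τ j ^ t) Filter.atTop (nhds 0) := by
    rw [show (0 : ℝ) = ∑ j : Fin n, 0 by simp]
    exact tendsto_finsetSum _ fun j _ =>
      tendsto_rpow_atTop_of_base_lt_one _ (by linarith [h0 j]) (h1 j)
  obtain ⟨T, hT, hT0⟩ := ((hlim.eventually (gt_mem_nhds one_pos)).and
    (Filter.eventually_ge_atTop 0)).exists
  have hc : ContinuousOn (fun t : ℝ => ∑ j, τ j ^ t) (Set.Icc 0 T) := by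
    refine Continuous.continuousOn ?_
    refine continuous_finsetSum _ fun j _ => ?_
    exact Real.continuous_const_rpow (h0 j).ne'
  have h2 : (2 : ℝ) ≤ n := by exact_mod_cast hn
  obtain ⟨t, ht, htt⟩ := intermediate_value_Icc' hT0 hc
    (show (1 : ℝ) ∈ Set.Icc _ _ from ⟨hT.le, by simp; linarith⟩)
  refine ⟨t, lt_of_le_of_ne ht.1 ?_, htt⟩
  rintro rfl
  simp at htt
  have : n = 1 := by exact_mod_cast htt
  omega

lemma fm_sup {m : ℕ} (R : List (Fin m) → ℝ) (hpos : ∀ w, 0 < R w) (M : ℝ) (hM : ∀ w, R w ≤ M)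
    (Q : Set ℝ) (hQ : Q.Finite) (hR : ∀ w a, R (w ++ [a]) / R w ∈ Q) :
    ∃ T, (∃ i, T < R i) ∧ ∀ w, T < R w → ∀ a, R (w ++ [a]) ≤ R w := by
  obtain ⟨η, hη1, hη⟩ : ∃ η > 1, ∀ q ∈ Q, q < η → q ≤ 1 := by
    have : ∀ᶠ η in nhdsWithin (1 : ℝ) (Set.Ioi 1), ∀ q ∈ Q, q < η → q ≤ 1 := by
      rw [Filter.eventually_all_finite hQ]
      intro q _
      by_cases hq : q ≤ 1
      · exact Filter.Eventually.of_forall fun _ _ => hq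
      · push Not at hq
        filter_upwards [mem_nhdsWithin_of_mem_nhds (gt_mem_nhds hq)] with η h1 h2
        linarith
    obtain ⟨η, h1, h2⟩ := (this.and self_mem_nhdsWithin).exists
    exact ⟨η, h2, h1⟩
  have hb : BddAbove (Set.range R) := ⟨M, by rintro _ ⟨w, rfl⟩; exact hM w⟩
  have hS : 0 < sSup (Set.range R) := (hpos []).trans_le (le_csSup hb ⟨[], rfl⟩)
  have hlt : sSup (Set.range R) / η < sSup (Set.range R) := div_lt_self hS hη1
  refine ⟨sSup (Set.range R) / η, ?_, ?_⟩
  · obtain ⟨_, ⟨i, rfl⟩, hi⟩ := exists_lt_of_lt_csSup (Set.range_nonempty R) hlt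
    exact ⟨i, hi⟩
  · intro w hw a
    have h1 := le_csSup hb ⟨w ++ [a], rfl⟩
    have h2 := hη _ (hR w a) (by
      rw [div_lt_iff₀ (hpos w)]
      rw [div_lt_iff₀ (by linarith)] at hw
      linarith)
    rwa [div_le_one (hpos w)] at h2

lemma fm_const {m : ℕ} (p : Fin m → ℝ) (hp : ∀ a, 0 < p a)
    (R : List (Fin m) → ℝ) (c M : ℝ) (hc : 0 < c) (hcR : ∀ w, c ≤ R w) (hM : ∀ w, R w ≤ M)
    (hsum : ∀ w, R w = ∑ a, p a * R (w ++ [a]))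
    (Q : Set ℝ) (hQ : Q.Finite) (hR : ∀ w a, R (w ++ [a]) / R w ∈ Q) :
    ∃ i, ∀ w, R (i ++ w) = R i := by
  have hpos : ∀ w, 0 < R w := fun w => hc.trans_le (hcR w)
  obtain ⟨T, ⟨i, hi⟩, hT⟩ := fm_sup R hpos M hM Q hQ hR
  obtain ⟨T', ⟨i', hi'⟩, hT'⟩ := fm_sup (fun w => (R w)⁻¹) (fun w => inv_pos.2 (hpos w)) c⁻¹
    (fun w => inv_anti₀ hc (hcR w)) ((fun x => x⁻¹) '' Q) (hQ.image _) (fun w a =>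
      ⟨_, hR w a, by simp [div_eq_mul_inv, mul_comm]⟩)
  have hle : ∑ a, p a ≤ 1 := by
    have h1 : ∀ a, R i' ≤ R (i' ++ [a]) := fun a =>
      (inv_le_inv₀ (hpos _) (hpos _)).1 (hT' i' hi' a)
    have h2 : (∑ a, p a) * R i' ≤ 1 * R i' := by
      rw [one_mul]
      conv_rhs => rw [hsum i']
      rw [Finset.sum_mul]
      exact Finset.sum_le_sum fun a _ => mul_le_mul_of_nonneg_left (h1 a) (hp a).le
    exact le_of_mul_le_mul_right h2 (hpos _)
  have step : ∀ w, T < R w → ∀ a, R (w ++ [a]) = R w := by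
    intro w hw
    have h1 := hT w hw
    have h2 : ∑ a, p a * (R w - R (w ++ [a])) ≤ 0 := by
      simp only [mul_sub, Finset.sum_sub_distrib, ← hsum, ← Finset.sum_mul]
      nlinarith [hpos w]
    have h3 : ∀ a ∈ Finset.univ, 0 ≤ p a * (R w - R (w ++ [a])) := fun a _ =>
      mul_nonneg (hp a).le (sub_nonneg.2 (h1 a))
    have h4 := (Finset.sum_eq_zero_iff_of_nonneg h3).1 (le_antisymm h2 (Finset.sum_nonneg h3))
    intro a
    have := (mul_eq_zero.1 (h4 a (Finset.mem_univ a))).resolve_left (hp a).ne'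
    linarith
  refine ⟨i, fun w => ?_⟩
  induction w using List.reverseRecOn with
  | nil => simp
  | append_singleton w a ih =>
    rw [← List.append_assoc, step (i ++ w) (by rw [ih]; exact hi), ih]

lemma fm_key {X Y : Type*} [MetricSpace X] [MetricSpace Y] {m n : ℕ} {E : Set X} {F : Set Y}
    {ρ : Fin m → ℝ} {τ : Fin n → ℝ} {φ : Fin m → X → X} {ψ : Fin n → Y → Y}
    (hE : FMDust E ρ φ) (hF : FMDust F τ ψ) (f : X → Y) (hmaps : ∀ x ∈ E, f x ∈ F)
    (hsurj : ∀ y ∈ F, ∃ x ∈ E, f x = y) (C : ℝ) (hC : 0 < C)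
    (hl : ∀ x ∈ E, ∀ y ∈ E, C⁻¹ * dist x y ≤ dist (f x) (f y))
    (hu : ∀ x ∈ E, ∀ y ∈ E, dist (f x) (f y) ≤ C * dist x y) :
    ∃ K : ℕ, ∃ c1 > 0, ∃ c2, ∀ w, ∃ j, f '' fmCyl E φ w ⊆ fmCyl F ψ j ∧
      c1 * fmR ρ w ≤ fmR τ j ∧ fmR τ j ≤ c2 * fmR ρ w ∧
      ∀ u : List (Fin m), u.length ≤ 1 → ∀ k : List (Fin n), k.length = K →
        (f '' fmCyl E φ (w ++ u) ∩ fmCyl F ψ (j ++ k)).Nonempty →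
          fmCyl F ψ (j ++ k) ⊆ f '' fmCyl E φ (w ++ u) := by
  obtain ⟨δE, hδE, hsE⟩ := hE.exists_sep'
  obtain ⟨δF, hδF, hsF⟩ := hF.exists_sep'
  obtain ⟨DE, hDE, hdE⟩ := hE.exists_diam
  obtain ⟨DF, hDF, hdF⟩ := hF.exists_diam
  obtain ⟨rmin, hrm0, hrm1, hrm⟩ := hE.exists_min
  obtain ⟨tmin, htm0, htm1, htm⟩ := hF.exists_min
  obtain ⟨tmax, htM0, htM1, htM⟩ := hF.exists_max
  set A : ℝ := C * DE / δF + 1 with hA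
  have hA0 : 0 < A := by positivity
  have hA1 : C * DE < δF * A := by
    rw [hA, mul_add, mul_div_cancel₀ _ hδF.ne']; linarith
  obtain ⟨K, hK⟩ := exists_pow_lt_of_lt_one
    (show 0 < C⁻¹ * δE * rmin * tmin / A / DF by positivity) htM1
  rw [lt_div_iff₀ hDF] at hK
  refine ⟨K, min 1 A, by positivity, A / tmin, fun w => ?_⟩
  obtain ⟨x0, hx0⟩ : (fmCyl E φ w).Nonempty := hE.ne.image _
  have hr := fmR_pos hE.pos w
  obtain ⟨j, hyj, hj, hj2⟩ := hF.exists_stop htm (hmaps x0 (hE.cyl_sub w hx0))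
    (show 0 < A * fmR ρ w by positivity)
  have hjp := fmR_pos hF.pos j
  refine ⟨j, ?_, ?_, ?_, ?_⟩
  · rintro _ ⟨x, hx, rfl⟩
    have hxE := hE.cyl_sub w hx
    rcases hj with rfl | hj
    · simpa [fmCyl, fmPhi] using hmaps x hxE
    by_contra hcon
    have h1 := hsF j _ hyj _ (hmaps x hxE) hcon
    have h2 := hu x0 (hE.cyl_sub w hx0) x hxE
    have h3 := hdE w x0 hx0 x hx
    have h4 : C * dist x0 x ≤ C * (DE * fmR ρ w) := mul_le_mul_of_nonneg_left h3 hC.le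
    have h5 : δF * (A * fmR ρ w) ≤ δF * fmR τ j := mul_le_mul_of_nonneg_left hj hδF.le
    have h6 := mul_lt_mul_of_pos_right hA1 hr
    linarith
  · rcases hj with rfl | hj
    · rw [fmR_nil]
      exact mul_le_one₀ (min_le_left _ _) hr.le (hE.r_le_one w)
    · exact (mul_le_mul_of_nonneg_right (min_le_right _ _) hr.le).trans hj
  · rw [div_mul_eq_mul_div, le_div_iff₀ htm0]; exact hj2
  · rintro u hlen k hk ⟨_, ⟨x, hx, rfl⟩, hyk⟩ y' hy'
    obtain ⟨x', hx', rfl⟩ := hsurj y' (hF.cyl_sub _ hy')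
    by_contra hcon
    have hn : x' ∉ fmCyl E φ (w ++ u) := fun hh => hcon ⟨x', hh, rfl⟩
    have h1 := hsE _ x hx x' hx' hn
    have h2 := hl x (hE.cyl_sub _ hx) x' hx'
    have h3 := hdF _ _ hyk _ hy'
    rw [fmR_append] at h1 h3
    have h4 := fmR_le hF.pos htM htM0.le k
    rw [hk] at h4
    have h5 : rmin ≤ fmR ρ u := by
      refine le_trans ?_ (fmR_ge hrm hrm0 u)
      simpa using pow_le_pow_of_le_one hrm0.le hrm1 hlen
    have h6 : DF * (fmR τ j * fmR τ k) < C⁻¹ * δE * rmin * tmin / A * fmR τ j := by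
      calc DF * (fmR τ j * fmR τ k) ≤ DF * (fmR τ j * tmax ^ K) := by gcongr
        _ = tmax ^ K * DF * fmR τ j := by ring
        _ < _ := mul_lt_mul_of_pos_right hK hjp
    have h7 : C⁻¹ * δE * rmin * tmin / A * fmR τ j ≤ C⁻¹ * (δE * (fmR ρ w * fmR ρ u)) := by
      calc C⁻¹ * δE * rmin * tmin / A * fmR τ j
          = C⁻¹ * δE * rmin / A * (fmR τ j * tmin) := by ring
        _ ≤ C⁻¹ * δE * rmin / A * (A * fmR ρ w) := by gcongr
        _ = C⁻¹ * (δE * (fmR ρ w * rmin)) := by field_simp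
        _ ≤ _ := by gcongr
    have h8 : C⁻¹ * (δE * (fmR ρ w * fmR ρ u)) ≤ C⁻¹ * dist x x' :=
      mul_le_mul_of_nonneg_left h1 (by positivity)
    linarith

open Classical in
def fmSig {n : ℕ} (p : Fin n → ℝ) (K : ℕ) (S : Set (Fin K → Fin n)) : ℝ :=
  ∑ k : Fin K → Fin n, if k ∈ S then fmR p (List.ofFn k) else 0

lemma fm_nu_split {Y : Type*} [MetricSpace Y] {n : ℕ} {F : Set Y}
    {τ : Fin n → ℝ} {ψ : Fin n → Y → Y} (hF : FMDust F τ ψ) (ν : Set Y → ℝ)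
    (hν : ∀ (k : ℕ) (B : Fin k → Set Y), (Pairwise fun a b => Disjoint (B a) (B b)) →
        ν (⋃ a, B a) = ∑ a, ν (B a)) (A : Set Y) (K : ℕ) (j : List (Fin n)) :
    ν (A ∩ fmCyl F ψ j) = ∑ k : Fin K → Fin n, ν (A ∩ fmCyl F ψ (j ++ List.ofFn k)) := by
  induction K generalizing j with
  | zero => simp
  | succ K ih =>
    rw [hF.cyl_split, Set.inter_iUnion, hν _ _ (fun a b hab =>
      (hF.cyl_disj j hab).mono Set.inter_subset_right Set.inter_subset_right)]
    rw [← (Fin.consEquiv (fun _ : Fin (K+1) => Fin n)).sum_comp, Fintype.sum_prod_type]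
    refine Finset.sum_congr rfl fun a _ => ?_
    rw [ih]
    refine Finset.sum_congr rfl fun k _ => ?_
    simp [Fin.consEquiv, List.ofFn_succ]

lemma fm_nu_sat {Y : Type*} [MetricSpace Y] {n : ℕ} {F : Set Y}
    {τ : Fin n → ℝ} {ψ : Fin n → Y → Y} (hF : FMDust F τ ψ) (ν : Set Y → ℝ)
    (hν : ∀ (k : ℕ) (B : Fin k → Set Y), (Pairwise fun a b => Disjoint (B a) (B b)) →
        ν (⋃ a, B a) = ∑ a, ν (B a)) (p : Fin n → ℝ) (hp : ∀ w, ν (fmCyl F ψ w) = fmR p w)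
    (A : Set Y) (K : ℕ) (j : List (Fin n)) (hA : A ⊆ fmCyl F ψ j)
    (hs : ∀ k : List (Fin n), k.length = K → (A ∩ fmCyl F ψ (j ++ k)).Nonempty →
      fmCyl F ψ (j ++ k) ⊆ A) :
    ν A = fmR p j * fmSig p K {k | (A ∩ fmCyl F ψ (j ++ List.ofFn k)).Nonempty} := by
  have h0 : ν ∅ = 0 := by
    have := hν 0 (fun _ => ∅) (fun a => a.elim0)
    simpa using this
  have h1 := fm_nu_split hF ν hν A K j
  rw [Set.inter_eq_left.2 hA] at h1
  rw [h1, fmSig, Finset.mul_sum]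
  refine Finset.sum_congr rfl fun k _ => ?_
  split_ifs with h
  · rw [Set.inter_eq_right.2 (hs _ (by simp) h), hp, fmR_append]
  · rw [Set.not_nonempty_iff_eq_empty.1 h, h0, mul_zero]

lemma fm_main {X Y : Type*} [MetricSpace X] [MetricSpace Y] {m n : ℕ} (hn : 2 ≤ n)
    {E : Set X} {F : Set Y}
    {ρ : Fin m → ℝ} {τ : Fin n → ℝ} {φ : Fin m → X → X} {ψ : Fin n → Y → Y}
    (hE : FMDust E ρ φ) (hF : FMDust F τ ψ) (f : X → Y) (hmaps : ∀ x ∈ E, f x ∈ F)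
    (hsurj : ∀ y ∈ F, ∃ x ∈ E, f x = y) (C : ℝ) (hC : 0 < C)
    (hl : ∀ x ∈ E, ∀ y ∈ E, C⁻¹ * dist x y ≤ dist (f x) (f y))
    (hu : ∀ x ∈ E, ∀ y ∈ E, dist (f x) (f y) ≤ C * dist x y) (a : Fin m) :
    ∃ P : ℕ, 0 < P ∧ ∃ e : Fin n → ℕ, P * Real.log (ρ a) = ∑ b, (e b : ℝ) * Real.log (τ b) := by
  have hinj : Set.InjOn f E := by
    intro x hx y hy hxy
    have := hl x hx y hy
    rw [hxy, dist_self] at this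
    have h2 : 0 < C⁻¹ := inv_pos.2 hC
    have h3 : dist x y ≤ 0 := by
      by_contra! h
      have := mul_pos h2 h
      linarith
    exact dist_le_zero.1 h3
  obtain ⟨t, ht0, hts⟩ := fm_exists_t hn τ hF.pos hF.lt
  have htp : ∀ b, 0 < τ b ^ t := fun b => Real.rpow_pos_of_pos (hF.pos b) t
  have hrp : ∀ b, 0 < ρ b ^ t := fun b => Real.rpow_pos_of_pos (hE.pos b) t
  obtain ⟨ν, hν, hνc⟩ := hF.exists_nu (fun b => τ b ^ t) (fun b => (htp b).le) hts
  obtain ⟨K, c1, hc1, c2, hkey⟩ := fm_key hE hF f hmaps hsurj C hC hl hu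
  choose j hsub hlow hupp hsat using hkey
  set p : Fin n → ℝ := fun b => τ b ^ t with hp
  let S : List (Fin m) → List (Fin m) → Set (Fin K → Fin n) := fun w u =>
    {k | (f '' fmCyl E φ (w ++ u) ∩ fmCyl F ψ (j w ++ List.ofFn k)).Nonempty}
  have hcs : ∀ w u, fmCyl E φ (w ++ u) ⊆ fmCyl E φ w := by
    rintro w u _ ⟨x, hx, rfl⟩
    rw [fmPhi_append]
    exact ⟨_, hE.maps' u hx, rfl⟩
  let G : List (Fin m) → ℝ := fun w => ν (f '' fmCyl E φ w)
  have hG : ∀ w u, u.length ≤ 1 → G (w ++ u) = fmR τ (j w) ^ t * fmSig p K (S w u) := by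
    intro w u hlen
    rw [← fmR_rpow hF.pos]
    exact fm_nu_sat hF ν hν p hνc _ K (j w) ((Set.image_mono (hcs w u)).trans (hsub w))
      (hsat w u hlen)
  have hG0 : ∀ w, G w = fmR τ (j w) ^ t * fmSig p K (S w []) := by
    intro w
    simpa using hG w [] (by simp)
  have hSne : ∀ w, (S w []).Nonempty := by
    intro w
    by_contra hcon
    rw [Set.not_nonempty_iff_eq_empty] at hcon
    obtain ⟨x0, hx0⟩ : (fmCyl E φ w).Nonempty := hE.ne.image _
    have h1 : ∀ K' (j' : List (Fin n)), f x0 ∈ fmCyl F ψ j' →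
        ∃ k : Fin K' → Fin n, f x0 ∈ fmCyl F ψ (j' ++ List.ofFn k) := by
      intro K'
      induction K' with
      | zero => intro j' h; exact ⟨Fin.elim0, by simpa using h⟩
      | succ K' ih =>
        intro j' h
        rw [hF.cyl_split] at h
        obtain ⟨b, hb⟩ := Set.mem_iUnion.1 h
        obtain ⟨k, hk⟩ := ih _ hb
        exact ⟨Fin.cons b k, by simpa [List.ofFn_succ] using hk⟩
    obtain ⟨k, hk⟩ := h1 K (j w) (hsub w ⟨x0, hx0, rfl⟩)
    have : k ∈ S w [] := ⟨f x0, ⟨x0, by simpa using hx0, rfl⟩, hk⟩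
    rw [hcon] at this
    exact this
  have hpk : ∀ k : List (Fin n), 0 < fmR p k := fmR_pos htp
  obtain ⟨s0, hs0, hs0'⟩ : ∃ s0 > 0, ∀ T : Set (Fin K → Fin n), T.Nonempty →
      s0 ≤ fmSig p K T := by
    obtain ⟨k0, -⟩ := hSne []
    have : Nonempty (Fin K → Fin n) := ⟨k0⟩
    obtain ⟨k1, hk1⟩ := Finite.exists_min (fun k : Fin K → Fin n => fmR p (List.ofFn k))
    refine ⟨_, hpk (List.ofFn k1), ?_⟩
    rintro T ⟨k, hk⟩
    refine (hk1 k).trans ?_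
    unfold fmSig
    refine le_trans (by rw [if_pos hk]) (Finset.single_le_sum (f := fun k => _)
      (fun k _ => ?_) (Finset.mem_univ k))
    split_ifs
    · exact (hpk _).le
    · exact le_rfl
  have hs1 : ∀ T : Set (Fin K → Fin n), fmSig p K T ≤ fmSig p K Set.univ := by
    intro T
    unfold fmSig
    refine Finset.sum_le_sum fun k _ => ?_
    simp only [Set.mem_univ, if_true]
    split_ifs
    · exact le_rfl
    · exact (hpk _).le
  have hrw : ∀ w, 0 < fmR ρ w ^ t := fun w => Real.rpow_pos_of_pos (fmR_pos hE.pos w) t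
  have hjw : ∀ w, 0 < fmR τ (j w) ^ t := fun w => Real.rpow_pos_of_pos (fmR_pos hF.pos _) t
  have hGpos : ∀ w, 0 < G w := fun w => by
    rw [hG0]; exact mul_pos (hjw w) (hs0.trans_le (hs0' _ (hSne w)))
  have hGsum : ∀ w, G w = ∑ b, G (w ++ [b]) := by
    intro w
    have : f '' fmCyl E φ w = ⋃ b, f '' fmCyl E φ (w ++ [b]) := by
      rw [hE.cyl_split, Set.image_iUnion]
    show ν _ = _
    rw [this, hν _ _ ?_]
    intro b c hbc
    refine Set.disjoint_left.2 ?_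
    rintro _ ⟨x, hx, rfl⟩ ⟨y, hy, hxy⟩
    have := hinj (hE.cyl_sub _ hy) (hE.cyl_sub _ hx) hxy
    subst this
    exact Set.disjoint_left.1 (hE.cyl_disj w hbc) hx hy
  have hc2 : 0 < c2 := by
    have := hupp []
    rw [fmR_nil, mul_one] at this
    exact (fmR_pos hF.pos _).trans_le this
  have hrs : ∀ w b, fmR ρ (w ++ [b]) ^ t = fmR ρ w ^ t * ρ b ^ t := by
    intro w b
    rw [fmR_append, Real.mul_rpow (fmR_pos hE.pos w).le (fmR_pos hE.pos _).le]
    simp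
  obtain ⟨i, hi⟩ := fm_const (fun b => ρ b ^ t) hrp (fun w => G w / fmR ρ w ^ t)
    (c1 ^ t * s0) (c2 ^ t * fmSig p K Set.univ)
    (mul_pos (Real.rpow_pos_of_pos hc1 t) hs0)
    (fun w => by
      rw [le_div_iff₀ (hrw w), hG0]
      have h1 : c1 ^ t * fmR ρ w ^ t ≤ fmR τ (j w) ^ t := by
        rw [← Real.mul_rpow hc1.le (fmR_pos hE.pos w).le]
        exact Real.rpow_le_rpow (mul_pos hc1 (fmR_pos hE.pos w)).le (hlow w) ht0.le
      calc c1 ^ t * s0 * fmR ρ w ^ t = (c1 ^ t * fmR ρ w ^ t) * s0 := by ring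
        _ ≤ _ := mul_le_mul h1 (hs0' _ (hSne w)) hs0.le (hjw w).le)
    (fun w => by
      rw [div_le_iff₀ (hrw w), hG0]
      have h1 : fmR τ (j w) ^ t ≤ c2 ^ t * fmR ρ w ^ t := by
        rw [← Real.mul_rpow hc2.le (fmR_pos hE.pos w).le]
        exact Real.rpow_le_rpow (fmR_pos hF.pos _).le (hupp w) ht0.le
      calc _ ≤ (c2 ^ t * fmR ρ w ^ t) * fmSig p K Set.univ :=
            mul_le_mul h1 (hs1 _) (hs0.le.trans (hs0' _ (hSne w)))
              (mul_pos (Real.rpow_pos_of_pos hc2 t) (hrw w)).le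
        _ = _ := by ring)
    (fun w => by
      rw [hGsum, Finset.sum_div]
      refine Finset.sum_congr rfl fun b _ => ?_
      rw [hrs]
      have h1 := (hrw w).ne'
      have h2 := (hrp b).ne'
      field_simp)
    (Set.range fun q : (Set (Fin K → Fin n) × Set (Fin K → Fin n)) × Fin m =>
      fmSig p K q.1.1 / fmSig p K q.1.2 / ρ q.2 ^ t) (Set.finite_range _)
    (fun w b => ⟨((S w [b], S w []), b), by
      simp only
      rw [hG w [b] (by simp), hG0 w, hrs]
      have h1 := (hrw w).ne'
      have h2 := (hrp b).ne'
      have h3 := (hjw w).ne'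
      have h4 := (hs0.trans_le (hs0' _ (hSne w))).ne'
      field_simp⟩)
  -- pigeonhole
  let v : ℕ → List (Fin m) := fun N => i ++ List.replicate N a
  have hwqo : WellQuasiOrdered (fun (x y : Set (Fin K → Fin n) × (Fin n → ℕ)) =>
      x.1 = y.1 ∧ x.2 ≤ y.2) :=
    WellQuasiOrdered.prod (Finite.wellQuasiOrdered _) (wellQuasiOrdered_le)
  obtain ⟨N, N', hNN, hS, hcount⟩ := hwqo fun N => (S (v N) [], fun b => (j (v N)).count b)
  simp only at hS hcount
  have hval : ∀ N, fmR τ (j (v N)) ^ t * fmSig p K (S (v N) []) =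
      G i * (ρ a ^ N) ^ t := by
    intro N
    have h1 := hi (List.replicate N a)
    rw [← hG0]
    have h2 : fmR ρ (i ++ List.replicate N a) = fmR ρ i * ρ a ^ N := by
      rw [fmR_append]; simp [fmR]
    rw [div_eq_div_iff (hrw _).ne' (hrw _).ne', h2,
      Real.mul_rpow (fmR_pos hE.pos i).le (pow_pos (hE.pos a) N).le] at h1
    have h3 := (hrw i).ne'
    apply mul_right_cancel₀ h3
    rw [h1]; ring
  have hlog : ∀ N, t * Real.log (fmR τ (j (v N))) + Real.log (fmSig p K (S (v N) [])) =
      Real.log (G i) + t * (N * Real.log (ρ a)) := by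
    intro N
    have := congrArg Real.log (hval N)
    rw [Real.log_mul (hjw _).ne' (hs0.trans_le (hs0' _ (hSne _))).ne',
      Real.log_mul (hGpos _).ne' (Real.rpow_pos_of_pos (pow_pos (hE.pos a) N) t).ne',
      Real.log_rpow (fmR_pos hF.pos _), Real.log_rpow (pow_pos (hE.pos a) N), Real.log_pow] at this
    exact this
  refine ⟨N' - N, by omega, fun b => (j (v N')).count b - (j (v N)).count b, ?_⟩
  have e1 := hlog N
  have e2 := hlog N'
  rw [hS] at e1
  have e3 : t * (((N' - N : ℕ) : ℝ) * Real.log (ρ a)) =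
      t * (Real.log (fmR τ (j (v N'))) - Real.log (fmR τ (j (v N)))) := by
    rw [Nat.cast_sub hNN.le]; linarith
  rw [mul_left_cancel₀ ht0.ne' e3, (fmR_log τ hF.pos _).2, (fmR_log τ hF.pos _).2,
    ← Finset.sum_sub_distrib]
  refine Finset.sum_congr rfl fun b _ => ?_
  rw [Nat.cast_sub (hcount b)]
  ring

lemma fm_vplus {m n : ℕ} (ρ : Fin m → ℝ) (τ : Fin n → ℝ)
    (h : ∀ a, ∃ P : ℕ, 0 < P ∧ ∃ e : Fin n → ℕ,
      P * Real.log (ρ a) = ∑ b, (e b : ℝ) * Real.log (τ b)) : Vplus ρ ⊆ Vplus τ := by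
  choose P hP e he using h
  rintro x ⟨q, hq, rfl⟩
  refine ⟨fun b => ∑ a, q a * (e a b / P a), fun b => Finset.sum_nonneg fun a _ =>
    mul_nonneg (hq a) (by positivity), ?_⟩
  push_cast
  simp only [Finset.sum_mul]
  rw [Finset.sum_comm]
  refine Finset.sum_congr rfl fun a _ => ?_
  have h1 : (P a : ℝ) ≠ 0 := by exact_mod_cast (hP a).ne'
  have h2 : Real.log (ρ a) = (∑ b, (e a b : ℝ) * Real.log (τ b)) / P a := by
    rw [← he a]; field_simp
  rw [h2, Finset.sum_div, Finset.mul_sum]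
  refine Finset.sum_congr rfl fun b _ => ?_
  ring

lemma fm_half {d d' m n : ℕ} (hn : 2 ≤ n)
    (ρ : Fin m → ℝ) (τ : Fin n → ℝ)
    (E : Set (EuclideanSpace ℝ (Fin d))) (F : Set (EuclideanSpace ℝ (Fin d')))
    (hE : IsDustLike E ρ) (hF : IsDustLike F τ) (h : LipEquiv E F) :
    Vplus ρ ⊆ Vplus τ := by
  obtain ⟨e1, e2, e3, φ, e4, e5, e6⟩ := hE
  obtain ⟨f1, f2, f3, ψ, f4, f5, f6⟩ := hF
  obtain ⟨f, hf, C, hC, hfC⟩ := h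
  have hE : FMDust E ρ φ := ⟨e1, e2, fun j => (e3 j).1, fun j => (e3 j).2, e4, e5, e6⟩
  have hF : FMDust F τ ψ := ⟨f1, f2, fun j => (f3 j).1, fun j => (f3 j).2, f4, f5, f6⟩
  classical
  let g : EuclideanSpace ℝ (Fin d) → EuclideanSpace ℝ (Fin d') := fun x =>
    if hx : x ∈ E then (f ⟨x, hx⟩ : EuclideanSpace ℝ (Fin d')) else 0
  have hg : ∀ x (hx : x ∈ E), g x = f ⟨x, hx⟩ := fun x hx => dif_pos hx
  refine fm_vplus ρ τ (fm_main hn hE hF g (fun x hx => ?_) (fun y hy => ?_) C hC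
    (fun x hx y hy => ?_) (fun x hx y hy => ?_))
  · rw [hg x hx]; exact (f ⟨x, hx⟩).2
  · obtain ⟨x, hx⟩ := hf.2 ⟨y, hy⟩
    exact ⟨x, x.2, by rw [hg x x.2, Subtype.coe_eta, hx]⟩
  · rw [hg x hx, hg y hy]; exact (hfC ⟨x, hx⟩ ⟨y, hy⟩).1
  · rw [hg x hx, hg y hy]; exact (hfC ⟨x, hx⟩ ⟨y, hy⟩).2

lemma fm_symm {d d' : ℕ} (E : Set (EuclideanSpace ℝ (Fin d)))
    (F : Set (EuclideanSpace ℝ (Fin d'))) (h : LipEquiv E F) : LipEquiv F E := by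
  obtain ⟨f, hf, C, hC, hfC⟩ := h
  let e := Equiv.ofBijective f hf
  refine ⟨e.symm, e.symm.bijective, C, hC, fun x y => ?_⟩
  have h := hfC (e.symm x) (e.symm y)
  have h1 : ∀ z, f (e.symm z) = z := fun z => e.apply_symm_apply z
  rw [h1, h1] at h
  have hC' := hC.ne'
  constructor
  · rw [inv_mul_le_iff₀ hC]; exact h.2
  · have := h.1; rwa [inv_mul_le_iff₀ hC] at this

theorem stmt19 {d d' m n : ℕ} (hm : 2 ≤ m) (hn : 2 ≤ n)
    (ρ : Fin m → ℝ) (τ : Fin n → ℝ)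
    (E : Set (EuclideanSpace ℝ (Fin d))) (F : Set (EuclideanSpace ℝ (Fin d')))
    (hE : IsDustLike E ρ) (hF : IsDustLike F τ) (h : LipEquiv E F) :
    Vplus ρ = Vplus τ :=
  Set.Subset.antisymm (fm_half hn ρ τ E F hE hF h) (fm_half hm τ ρ F E hF hE (fm_symm E F h))
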